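/- Let G be a finite simple graph and k a positive integer. Then γ_{P,k}(G − e) > γ_{P,k}(G) for every edge e of G if and only if G is a disjoint union of k-generalized spiders, i.e., G is a forest in which every connected component contains at most one vertex of degree at least k + 2. -/

import Mathlib

open SimpleGraph

variable {V : Type*}

/-- The closed neighbourhood `N_G[v]` of a vertex. -/
def closedNbhd (G : SimpleGraph V) (v : V) : Set V := insert v (G.neighborSet v)

/-- The closed neighbourhood `N_G[X]` of a set of vertices. -/
def closedNbhdSet (G : SimpleGraph V) (X : Set V) : Set V := ⋃ v ∈ X, closedNbhd G v

/-- The sets `P^i_{G,k}(S)` of vertices monitored by `S` at step `i`. -/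
def monitored (G : SimpleGraph V) (k : ℕ) (S : Set V) : ℕ → Set V
  | 0 => closedNbhdSet G S
  | i + 1 =>
      ⋃ v ∈ {w | w ∈ monitored G k S i ∧ (closedNbhd G w \ monitored G k S i).ncard ≤ k},
        closedNbhd G v

/-- `S` is a `k`-power dominating set of `G`. -/
def IsPDS (G : SimpleGraph V) (k : ℕ) (S : Set V) : Prop :=
  ∃ i, monitored G k S i = Set.univ

/-- The `k`-power domination number `γ_{P,k}(G)`. -/
noncomputable def pdn (G : SimpleGraph V) (k : ℕ) : ℕ :=
  sInf {n | ∃ S : Set V, IsPDS G k S ∧ S.ncard = n}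

/-- The radius `rad_{P,k}(G,S)` of a `k`-PDS `S`. -/
noncomputable def radPDS (G : SimpleGraph V) (k : ℕ) (S : Set V) : ℕ :=
  1 + sInf {i | monitored G k S i = Set.univ}

/-- The `k`-propagation radius `rad_{P,k}(G)`. -/
noncomputable def propRad (G : SimpleGraph V) (k : ℕ) : ℕ :=
  sInf {r | ∃ S : Set V, IsPDS G k S ∧ S.ncard = pdn G k ∧ radPDS G k S = r}

theorem mem_closedNbhd {G : SimpleGraph V} {v x : V} :
    x ∈ closedNbhd G v ↔ x = v ∨ G.Adj v x := by
  simp [closedNbhd]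

theorem mem_closedNbhdSet {G : SimpleGraph V} {X : Set V} {x : V} :
    x ∈ closedNbhdSet G X ↔ ∃ v ∈ X, x ∈ closedNbhd G v := by
  simp [closedNbhdSet]

theorem mem_monitored_succ {G : SimpleGraph V} {k i : ℕ} {S : Set V} {x : V} :
    x ∈ monitored G k S (i + 1) ↔ ∃ v ∈ monitored G k S i,
      (closedNbhd G v \ monitored G k S i).ncard ≤ k ∧ x ∈ closedNbhd G v := by
  simp [monitored, and_assoc]

theorem subset_monitored_zero (G : SimpleGraph V) (k : ℕ) (S : Set V) :
    S ⊆ monitored G k S 0 := fun x hx =>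
  mem_closedNbhdSet.2 ⟨x, hx, mem_closedNbhd.2 (Or.inl rfl)⟩

theorem monitored_subset_succ (G : SimpleGraph V) (k : ℕ) (S : Set V) (i : ℕ) :
    monitored G k S i ⊆ monitored G k S (i + 1) := by
  have key : ∀ j v, v ∈ monitored G k S j → closedNbhd G v ⊆ monitored G k S j →
      closedNbhd G v ⊆ monitored G k S (j + 1) := fun j v hv hs x hx =>
    mem_monitored_succ.2 ⟨v, hv, by simp [Set.sdiff_eq_empty.2 hs], hx⟩
  induction i with
  | zero =>
    intro x hx
    obtain ⟨v, hv, hxv⟩ := mem_closedNbhdSet.1 hx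
    exact key 0 v (subset_monitored_zero G k S hv)
      (fun y hy => mem_closedNbhdSet.2 ⟨v, hv, hy⟩) hxv
  | succ i ih =>
    intro x hx
    obtain ⟨v, hv, hc, hxv⟩ := mem_monitored_succ.1 hx
    exact key (i + 1) v (ih hv) (fun y hy => mem_monitored_succ.2 ⟨v, hv, hc, hy⟩) hxv

theorem monitored_mono (G : SimpleGraph V) (k : ℕ) (S : Set V) : Monotone (monitored G k S) :=
  monotone_nat_of_le_succ (monitored_subset_succ G k S)

/-- Every monitored vertex lies in the connected component of a vertex of `S`. -/
theorem exists_reachable_of_mem_monitored {G : SimpleGraph V} {k : ℕ} {S : Set V} {i : ℕ} {x : V}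
    (hx : x ∈ monitored G k S i) : ∃ s ∈ S, G.Reachable s x := by
  induction i generalizing x with
  | zero =>
    obtain ⟨v, hv, hxv⟩ := mem_closedNbhdSet.1 hx
    rcases mem_closedNbhd.1 hxv with rfl | h
    · exact ⟨x, hv, Reachable.refl x⟩
    · exact ⟨v, hv, h.reachable⟩
  | succ i ih =>
    obtain ⟨v, hv, -, hxv⟩ := mem_monitored_succ.1 hx
    obtain ⟨s, hs, hsv⟩ := ih hv
    rcases mem_closedNbhd.1 hxv with rfl | h
    · exact ⟨s, hs, hsv⟩
    · exact ⟨s, hs, hsv.trans h.reachable⟩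

theorem mem_or_exists_adj_of_mem_monitored {G : SimpleGraph V} {k : ℕ} {S : Set V} {i : ℕ} {x : V}
    (hx : x ∈ monitored G k S i) : x ∈ S ∨ ∃ w ∈ monitored G k S i, G.Adj w x := by
  induction i generalizing x with
  | zero =>
    obtain ⟨v, hv, hxv⟩ := mem_closedNbhdSet.1 hx
    rcases mem_closedNbhd.1 hxv with rfl | h
    · exact Or.inl hv
    · exact Or.inr ⟨v, subset_monitored_zero G k S hv, h⟩
  | succ i ih =>
    obtain ⟨v, hv, -, hxv⟩ := mem_monitored_succ.1 hx
    rcases mem_closedNbhd.1 hxv with rfl | h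
    · rcases ih hv with h | ⟨w, hw, h⟩
      · exact Or.inl h
      · exact Or.inr ⟨w, monitored_subset_succ G k S i hw, h⟩
    · exact Or.inr ⟨v, monitored_subset_succ G k S i hv, h⟩

theorem closedNbhd_subset_monitored_succ [Finite V] {G : SimpleGraph V} {k : ℕ} {S : Set V}
    (hdeg : ∀ v, k + 2 ≤ (G.neighborSet v).ncard → v ∈ S) {i : ℕ} {v : V}
    (hv : v ∈ monitored G k S i) : closedNbhd G v ⊆ monitored G k S (i + 1) := by
  by_cases hS : v ∈ S
  · intro x hx
    exact monitored_mono G k S (Nat.zero_le _) (mem_closedNbhdSet.2 ⟨v, hS, hx⟩)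
  obtain ⟨w, hw, hwv⟩ := (mem_or_exists_adj_of_mem_monitored hv).resolve_left hS
  have hle : (closedNbhd G v \ monitored G k S i).ncard ≤ k := by
    have hsub : closedNbhd G v \ monitored G k S i ⊆ G.neighborSet v \ {w} := by
      rintro x ⟨hx, hxm⟩
      rcases mem_closedNbhd.1 hx with rfl | h
      · exact absurd hv hxm
      · exact ⟨h, fun hxw => hxm (Set.mem_singleton_iff.1 hxw ▸ hw)⟩
    have h1 := Set.ncard_le_ncard hsub (Set.toFinite _)
    have h2 := Set.ncard_sdiff_singleton_add_one (s := G.neighborSet v) hwv.symm (Set.toFinite _)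
    have h3 : ¬ k + 2 ≤ (G.neighborSet v).ncard := fun h => hS (hdeg v h)
    omega
  exact fun x hx => mem_monitored_succ.2 ⟨v, hv, hle, hx⟩

/-- A set meeting every component and containing all vertices of degree at least `k + 2` is a
`k`-power dominating set. -/
theorem isPDS_of_forall_degree [Finite V] {G : SimpleGraph V} {k : ℕ} {S : Set V}
    (hdeg : ∀ v, k + 2 ≤ (G.neighborSet v).ncard → v ∈ S)
    (hreach : ∀ v, ∃ s ∈ S, G.Reachable s v) : IsPDS G k S := by
  have hmem : ∀ v, ∃ i, v ∈ monitored G k S i := by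
    intro v
    obtain ⟨s, hs, ⟨p⟩⟩ := hreach v
    have hwalk : ∀ {a b : V} (p : G.Walk a b), (∃ i, a ∈ monitored G k S i) →
        ∃ i, b ∈ monitored G k S i := by
      intro a b p
      induction p with
      | nil => exact id
      | cons h _ ih =>
        rintro ⟨i, hi⟩
        exact ih ⟨i + 1, closedNbhd_subset_monitored_succ hdeg hi (mem_closedNbhd.2 (Or.inr h))⟩
    exact hwalk p ⟨0, subset_monitored_zero G k S hs⟩
  choose f hf using hmem
  obtain ⟨N, hN⟩ := (Set.finite_range f).bddAbove
  exact ⟨N, Set.eq_univ_of_forall fun v => monitored_mono G k S (hN ⟨v, rfl⟩) (hf v)⟩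

theorem isPDS_univ (G : SimpleGraph V) (k : ℕ) : IsPDS G k Set.univ :=
  ⟨0, Set.univ_subset_iff.1 (subset_monitored_zero G k Set.univ)⟩

theorem exists_isPDS_ncard_eq_pdn (G : SimpleGraph V) (k : ℕ) :
    ∃ S : Set V, IsPDS G k S ∧ S.ncard = pdn G k :=
  Nat.sInf_mem (s := {n | ∃ S : Set V, IsPDS G k S ∧ S.ncard = n})
    ⟨_, Set.univ, isPDS_univ G k, rfl⟩

theorem IsPDS.pdn_le {G : SimpleGraph V} {k : ℕ} {S : Set V} (hS : IsPDS G k S) :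
    pdn G k ≤ S.ncard :=
  Nat.sInf_le ⟨S, hS, rfl⟩

theorem IsPDS.exists_reachable {G : SimpleGraph V} {k : ℕ} {S : Set V} (hS : IsPDS G k S) (v : V) :
    ∃ s ∈ S, G.Reachable s v := by
  obtain ⟨i, hi⟩ := hS
  exact exists_reachable_of_mem_monitored (hi ▸ Set.mem_univ v)

/-- If each component has at most one vertex of degree at least `k + 2`, then any set meeting every
component has at least `pdn G k` elements. -/
theorem pdn_le_ncard_of_forall_reachable [Finite V] {G : SimpleGraph V} {k : ℕ}
    (hbig : ∀ u v : V, G.Reachable u v →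
      k + 2 ≤ (G.neighborSet u).ncard → k + 2 ≤ (G.neighborSet v).ncard → u = v)
    {T : Set V} (hT : ∀ v, ∃ s ∈ T, G.Reachable s v) : pdn G k ≤ T.ncard := by
  have hrep : ∀ c : G.ConnectedComponent, ∃ w, G.connectedComponentMk w = c ∧
      ∀ u, G.connectedComponentMk u = c → k + 2 ≤ (G.neighborSet u).ncard → u = w := by
    intro c
    by_cases h : ∃ u, G.connectedComponentMk u = c ∧ k + 2 ≤ (G.neighborSet u).ncard
    · obtain ⟨w, hw, hwd⟩ := h
      exact ⟨w, hw, fun u hu hud =>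
        hbig u w (ConnectedComponent.eq.1 (hu.trans hw.symm)) hud hwd⟩
    · obtain ⟨w, hw⟩ := c.exists_rep
      exact ⟨w, hw, fun u hu hud => absurd ⟨u, hu, hud⟩ h⟩
  choose r hr hru using hrep
  have hS : IsPDS G k (Set.range r) := by
    apply isPDS_of_forall_degree
    · exact fun v hv => ⟨_, (hru _ v rfl hv).symm⟩
    · exact fun v => ⟨_, ⟨G.connectedComponentMk v, rfl⟩, ConnectedComponent.eq.1 (hr _)⟩
  have hsub : Set.range r ⊆ (fun v => r (G.connectedComponentMk v)) '' T := by
    rintro _ ⟨c, rfl⟩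
    obtain ⟨s, hs, hsr⟩ := hT (r c)
    exact ⟨s, hs, congrArg r ((ConnectedComponent.eq.2 hsr).trans (hr c))⟩
  exact hS.pdn_le.trans ((Set.ncard_le_ncard hsub (Set.toFinite _)).trans
    (Set.ncard_image_le (Set.toFinite _)))

theorem pdn_lt_pdn_deleteEdges_of_isBridge [Finite V] {G : SimpleGraph V} {k : ℕ}
    (hbig : ∀ u v : V, G.Reachable u v →
      k + 2 ≤ (G.neighborSet u).ncard → k + 2 ≤ (G.neighborSet v).ncard → u = v)
    {a b : V} (hab : G.Adj a b) (hbr : ¬ (G.deleteEdges {s(a, b)}).Reachable a b) :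
    pdn G k < pdn (G.deleteEdges {s(a, b)}) k := by
  obtain ⟨T, hT, hcard⟩ := exists_isPDS_ncard_eq_pdn (G.deleteEdges {s(a, b)}) k
  have hle : G.deleteEdges {s(a, b)} ≤ G := deleteEdges_le _
  obtain ⟨t, ht, hta⟩ := hT.exists_reachable a
  obtain ⟨t', ht', htb⟩ := hT.exists_reachable b
  have hne : t ≠ t' := by
    rintro rfl
    exact hbr (hta.symm.trans htb)
  have htt : G.Reachable t t' :=
    ((hta.mono hle).trans hab.reachable).trans (htb.mono hle).symm
  have hT' : ∀ v, ∃ s ∈ T \ {t'}, G.Reachable s v := by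
    intro v
    obtain ⟨s, hs, hsv⟩ := hT.exists_reachable v
    by_cases hst : s = t'
    · subst hst
      exact ⟨t, ⟨ht, hne⟩, htt.trans (hsv.mono hle)⟩
    · exact ⟨s, ⟨hs, hst⟩, hsv.mono hle⟩
  have h1 := pdn_le_ncard_of_forall_reachable hbig hT'
  have h2 := Set.ncard_sdiff_singleton_add_one ht' (Set.toFinite T)
  omega

/-- `IsMonitoringParent G k S p t` says that `t v` is the first step at which `v` is monitored, and
that `p v` is a neighbour of `v` responsible for it, unless `v ∈ S`, in which case `p v = v`. -/
structure IsMonitoringParent (G : SimpleGraph V) (k : ℕ) (S : Set V) (p : V → V) (t : V → ℕ) :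
    Prop where
  mem_iff : ∀ v i, v ∈ monitored G k S i ↔ t v ≤ i
  fixed : ∀ v ∈ S, p v = v
  adj : ∀ v ∉ S, G.Adj (p v) v
  parent : ∀ v ∉ S, p v ∈ S ∨ ∃ i, t v = i + 1 ∧ t (p v) ≤ i ∧
    (closedNbhd G (p v) \ monitored G k S i).ncard ≤ k

theorem IsPDS.exists_isMonitoringParent {G : SimpleGraph V} {k : ℕ} {S : Set V}
    (hS : IsPDS G k S) : ∃ p t, IsMonitoringParent G k S p t := by
  classical
  obtain ⟨N, hN⟩ := hS
  have hex : ∀ v, ∃ i, v ∈ monitored G k S i := fun v => ⟨N, hN ▸ Set.mem_univ v⟩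
  have hmem : ∀ v i, v ∈ monitored G k S i ↔ Nat.find (hex v) ≤ i := fun v i =>
    ⟨fun h => Nat.find_min' _ h, fun h => monitored_mono G k S h (Nat.find_spec (hex v))⟩
  have hp : ∀ v, ∃ w, (v ∈ S → w = v) ∧ (v ∉ S → G.Adj w v ∧ (w ∈ S ∨
      ∃ i, Nat.find (hex v) = i + 1 ∧ Nat.find (hex w) ≤ i ∧
        (closedNbhd G w \ monitored G k S i).ncard ≤ k)) := by
    intro v
    by_cases hv : v ∈ S
    · exact ⟨v, fun _ => rfl, fun h => absurd hv h⟩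
    have hspec := Nat.find_spec (hex v)
    obtain hz | ⟨i, hi⟩ : Nat.find (hex v) = 0 ∨ ∃ i, Nat.find (hex v) = i + 1 := by
      cases Nat.find (hex v) <;> simp
    · rw [hz] at hspec
      obtain ⟨w, hw, hvw⟩ := mem_closedNbhdSet.1 hspec
      rcases mem_closedNbhd.1 hvw with rfl | h
      · exact absurd hw hv
      · exact ⟨w, fun h => absurd h hv, fun _ => ⟨h, Or.inl hw⟩⟩
    · rw [hi] at hspec
      obtain ⟨w, hw, hc, hvw⟩ := mem_monitored_succ.1 hspec
      rcases mem_closedNbhd.1 hvw with rfl | h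
      · have := (hmem v i).1 hw
        omega
      · exact ⟨w, fun h => absurd h hv, fun _ => ⟨h, Or.inr ⟨i, hi, (hmem w i).1 hw, hc⟩⟩⟩
  choose p hp1 hp2 using hp
  exact ⟨p, fun v => Nat.find (hex v), hmem, hp1, fun v hv => (hp2 v hv).1,
    fun v hv => (hp2 v hv).2⟩

namespace IsMonitoringParent

variable {G : SimpleGraph V} {k : ℕ} {S : Set V} {p : V → V} {t : V → ℕ}

/-- Deleting an edge that does not join a vertex to its parent preserves monitoring. -/
theorem monitored_subset_deleteEdges [Finite V] (h : IsMonitoringParent G k S p t) {e : Sym2 V}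
    (he : ∀ v ∉ S, s(p v, v) ≠ e) (i : ℕ) :
    monitored G k S i ⊆ monitored (G.deleteEdges {e}) k S i := by
  have hadj : ∀ v ∉ S, v ∈ closedNbhd (G.deleteEdges {e}) (p v) := fun v hv =>
    mem_closedNbhd.2 (Or.inr (deleteEdges_adj.2 ⟨h.adj v hv, he v hv⟩))
  have hzero : ∀ v, v ∈ S ∨ p v ∈ S → v ∈ monitored (G.deleteEdges {e}) k S 0 := by
    intro v hv
    by_cases hvS : v ∈ S
    · exact subset_monitored_zero _ k S hvS
    · exact mem_closedNbhdSet.2 ⟨p v, hv.resolve_left hvS, hadj v hvS⟩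
  induction i with
  | zero =>
    intro v hv
    by_cases hvS : v ∈ S
    · exact hzero v (Or.inl hvS)
    rcases h.parent v hvS with hp | ⟨i, hi, -⟩
    · exact hzero v (Or.inr hp)
    · have := (h.mem_iff v 0).1 hv
      omega
  | succ i ih =>
    intro v hv
    by_cases hvi : v ∈ monitored G k S i
    · exact monitored_subset_succ _ k S i (ih hvi)
    by_cases hvS : v ∈ S
    · exact monitored_mono _ k S (Nat.zero_le _) (hzero v (Or.inl hvS))
    rcases h.parent v hvS with hp | ⟨j, hj, hjp, hc⟩
    · exact monitored_mono _ k S (Nat.zero_le _) (hzero v (Or.inr hp))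
    have h1 := (h.mem_iff v (i + 1)).1 hv
    have h2 := mt (h.mem_iff v i).2 hvi
    obtain rfl : j = i := by omega
    refine mem_monitored_succ.2 ⟨p v, ih ((h.mem_iff _ _).2 hjp), ?_, hadj v hvS⟩
    refine le_trans (Set.ncard_le_ncard ?_ (Set.toFinite _)) hc
    rintro x ⟨hx, hxm⟩
    refine ⟨mem_closedNbhd.2 ?_, fun hm => hxm (ih hm)⟩
    exact (mem_closedNbhd.1 hx).imp_right fun hx => (deleteEdges_adj.1 hx).1

theorem exists_parent_eq_of_pdn_lt [Finite V] (h : IsMonitoringParent G k S p t)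
    (hS : IsPDS G k S) {e : Sym2 V} (hlt : S.ncard < pdn (G.deleteEdges {e}) k) :
    ∃ v ∉ S, s(p v, v) = e := by
  by_contra! he
  obtain ⟨i, hi⟩ := hS
  have hS' : IsPDS (G.deleteEdges {e}) k S :=
    ⟨i, Set.univ_subset_iff.1 (hi ▸ h.monitored_subset_deleteEdges he i)⟩
  exact absurd hS'.pdn_le (not_le.2 hlt)

theorem not_iterate_parent_eq (h : IsMonitoringParent G k S p t) {v : V} (hv : v ∉ S) (n : ℕ) :
    p^[n] (p v) ≠ v := by
  have hstep : ∀ u, u ∉ S → p u ∉ S → t (p u) < t u := by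
    intro u hu hpu
    rcases h.parent u hu with hp | ⟨i, hi, hip, -⟩
    · exact absurd hp hpu
    · omega
  have hfix : ∀ n u, u ∈ S → p^[n] u ∈ S := by
    intro n u hu
    rw [Function.iterate_fixed (h.fixed u hu)]
    exact hu
  have hle : ∀ n u, p^[n] u ∉ S → t (p^[n] u) ≤ t u := by
    intro n
    induction n with
    | zero => exact fun u _ => le_rfl
    | succ n ih =>
      intro u hu
      rw [Function.iterate_succ_apply] at hu ⊢
      have hpu : p u ∉ S := fun hp => hu (hfix n _ hp)
      have huS : u ∉ S := fun hs => hpu (by rwa [h.fixed u hs])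
      exact (ih _ hu).trans (hstep u huS hpu).le
  intro hn
  have h1 := hle n (p v) (by rwa [hn])
  have h2 := hstep v hv (fun hp => hv (hn ▸ hfix n _ hp))
  rw [hn] at h1
  omega

/-- The set of vertices from which `u` is reached by iterating the parent map is closed under
adjacency in `H`, if the edges of `H` join vertices other than `u` to their parents. -/
theorem exists_iterate_eq_of_reachable {H : SimpleGraph V} {u : V}
    (hH : ∀ a b, H.Adj a b → (a ≠ u ∧ p a = b) ∨ (b ≠ u ∧ p b = a)) {v : V}
    (huv : H.Reachable u v) : ∃ n, p^[n] v = u := by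
  obtain ⟨w⟩ := huv
  have hwalk : ∀ {a b : V} (w : H.Walk a b), (∃ n, p^[n] a = u) → ∃ n, p^[n] b = u := by
    intro a b w
    induction w with
    | nil => exact id
    | @cons a b _ hab _ ih =>
      rintro ⟨n, hn⟩
      apply ih
      rcases hH a b hab with ⟨hau, rfl⟩ | ⟨-, rfl⟩
      · cases n with
        | zero => exact absurd hn hau
        | succ n => exact ⟨n, by rwa [Function.iterate_succ_apply] at hn⟩
      · exact ⟨n + 1, by rwa [Function.iterate_succ_apply]⟩
  exact hwalk w ⟨0, rfl⟩

theorem isAcyclic (h : IsMonitoringParent G k S p t)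
    (hG : ∀ e ∈ G.edgeSet, ∃ v ∉ S, s(p v, v) = e) : G.IsAcyclic := by
  rw [isAcyclic_iff_forall_isBridge]
  intro e he
  obtain ⟨v, hv, rfl⟩ := hG e he
  rw [Sym2.eq_swap, isBridge_iff]
  intro hr
  suffices hex : ∃ n, p^[n] (p v) = v by
    obtain ⟨n, hn⟩ := hex
    exact h.not_iterate_parent_eq hv n hn
  refine exists_iterate_eq_of_reachable (fun a b hab => ?_) hr
  obtain ⟨hab, hne⟩ := deleteEdges_adj.1 hab
  obtain ⟨x, -, hx⟩ := hG s(a, b) hab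
  rcases Sym2.eq_iff.1 hx with ⟨rfl, rfl⟩ | ⟨rfl, rfl⟩
  · exact Or.inr ⟨by rintro rfl; simp [Sym2.eq_swap] at hne, rfl⟩
  · exact Or.inl ⟨by rintro rfl; simp at hne, rfl⟩

theorem eq_of_reachable (h : IsMonitoringParent G k S p t)
    (hG : ∀ e ∈ G.edgeSet, ∃ v ∉ S, s(p v, v) = e) {u v : V} (hu : u ∈ S) (hv : v ∈ S)
    (huv : G.Reachable u v) : u = v := by
  suffices hex : ∃ n, p^[n] v = u by
    obtain ⟨n, hn⟩ := hex
    rw [Function.iterate_fixed (h.fixed v hv)] at hn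
    exact hn.symm
  refine exists_iterate_eq_of_reachable (fun a b hab => ?_) huv
  obtain ⟨x, hxS, hx⟩ := hG s(a, b) hab
  have hxu : x ≠ u := by
    rintro rfl
    exact hxS hu
  rcases Sym2.eq_iff.1 hx with ⟨rfl, rfl⟩ | ⟨rfl, rfl⟩
  · exact Or.inr ⟨hxu, rfl⟩
  · exact Or.inl ⟨hxu, rfl⟩

theorem ncard_children_le [Finite V] (h : IsMonitoringParent G k S p t) {v : V} (hv : v ∉ S) :
    {x | x ∉ S ∧ p x = v}.ncard ≤ k := by
  have hchild : ∀ x, x ∉ S ∧ p x = v → ∃ i, t x = i + 1 ∧ t v ≤ i ∧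
      (closedNbhd G v \ monitored G k S i).ncard ≤ k := by
    rintro x ⟨hx, rfl⟩
    exact (h.parent x hx).resolve_left hv
  have hmem : ∀ x, x ∉ S ∧ p x = v → x ∈ closedNbhd G v := by
    rintro x ⟨hx, rfl⟩
    exact mem_closedNbhd.2 (Or.inr (h.adj x hx))
  have hle : ∀ x y, x ∉ S ∧ p x = v → y ∉ S ∧ p y = v → t x ≤ t y := by
    intro x y hx hy
    obtain ⟨i, hi, hiv, hc⟩ := hchild y hy
    rw [hi, ← h.mem_iff]
    exact mem_monitored_succ.2 ⟨v, (h.mem_iff _ _).2 hiv, hc, hmem x hx⟩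
  rcases Set.eq_empty_or_nonempty {x | x ∉ S ∧ p x = v} with he | ⟨y, hy⟩
  · simp [he]
  obtain ⟨i, hi, -, hc⟩ := hchild y hy
  refine le_trans (Set.ncard_le_ncard ?_ (Set.toFinite _)) hc
  intro x hx
  refine ⟨hmem x hx, fun hxm => ?_⟩
  have h1 := (h.mem_iff x i).1 hxm
  have h2 := hle y x hy hx
  omega

theorem mem_of_le_ncard_neighborSet [Finite V] (h : IsMonitoringParent G k S p t)
    (hG : ∀ e ∈ G.edgeSet, ∃ v ∉ S, s(p v, v) = e) {v : V}
    (hv : k + 2 ≤ (G.neighborSet v).ncard) : v ∈ S := by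
  by_contra hvS
  have hsub : G.neighborSet v ⊆ insert (p v) {x | x ∉ S ∧ p x = v} := by
    intro y hy
    obtain ⟨x, hxS, hx⟩ := hG s(v, y) hy
    rcases Sym2.eq_iff.1 hx with ⟨hxv, rfl⟩ | ⟨hxy, rfl⟩
    · exact Or.inr ⟨hxS, hxv⟩
    · exact Or.inl hxy.symm
  have h1 := Set.ncard_le_ncard hsub (Set.toFinite _)
  have h2 := Set.ncard_insert_le (p v) {x | x ∉ S ∧ p x = v}
  have h3 := h.ncard_children_le hvS
  omega

end IsMonitoringParent

theorem pdn_every_edge_deletion_increases_iff_spiders {V : Type*} [Fintype V]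
    (G : SimpleGraph V) (k : ℕ) (hk : 0 < k) :
    (∀ e ∈ G.edgeSet, pdn G k < pdn (G.deleteEdges {e}) k) ↔
      (G.IsAcyclic ∧ ∀ u v : V, G.Reachable u v →
        k + 2 ≤ (G.neighborSet u).ncard → k + 2 ≤ (G.neighborSet v).ncard → u = v) := by
  constructor
  · intro hdel
    obtain ⟨S, hS, hcard⟩ := exists_isPDS_ncard_eq_pdn G k
    obtain ⟨p, t, h⟩ := hS.exists_isMonitoringParent
    have hG : ∀ e ∈ G.edgeSet, ∃ v ∉ S, s(p v, v) = e := fun e he =>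
      h.exists_parent_eq_of_pdn_lt hS (hcard ▸ hdel e he)
    exact ⟨h.isAcyclic hG, fun u v huv hu hv => h.eq_of_reachable hG
      (h.mem_of_le_ncard_neighborSet hG hu) (h.mem_of_le_ncard_neighborSet hG hv) huv⟩
  · rintro ⟨hac, hbig⟩ e he
    induction e with
    | h a b =>
      have hbr := isAcyclic_iff_forall_isBridge.1 hac he
      exact pdn_lt_pdn_deleteEdges_of_isBridge hbig he (isBridge_iff.1 hbr)
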